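/- Let G be a graph with no heavy seagull. Then no two vertices of degree at least three in G are at distance exactly two in G; consequently, every connected component of the subgraph of G induced by the set of vertices of degree at least three in G is a clique. In particular, if additionally G has no clique of size at least t+1, then γ_3(G) ≤ t − 1. -/

import Mathlib

open SimpleGraph Set List

namespace Paper

variable {V : Type} {W : Type}

/-- The closed neighborhood `N[v]` of a vertex. -/
def closedNbhd (G : SimpleGraph V) (v : V) : Set V := insert v (G.neighborSet v)

/-- The degree of a vertex (as the number of its neighbors). -/
noncomputable def deg (G : SimpleGraph V) (v : V) : ℕ := (G.neighborSet v).ncard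

/-- `G` contains `H` as an induced subgraph, i.e. some induced subgraph of `G` is
isomorphic to `H`. -/
def ContainsInduced (G : SimpleGraph V) (H : SimpleGraph W) : Prop :=
  ∃ s : Set V, Nonempty (H ≃g G.induce s)

/-- `(A, C, B)` is a separation of `G`. -/
def IsSeparation (G : SimpleGraph V) (A C B : Set V) : Prop :=
  A ∪ C ∪ B = Set.univ ∧ Disjoint A C ∧ Disjoint A B ∧ Disjoint C B ∧
    ∀ a ∈ A, ∀ b ∈ B, ¬G.Adj a b

/-- `G` admits a star cutset. -/
def HasStarCutset (G : SimpleGraph V) : Prop :=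
  ∃ A C B : Set V, IsSeparation G A C B ∧ A.Nonempty ∧ B.Nonempty ∧
    ∃ v ∈ C, C ⊆ closedNbhd G v

/-- `G` admits a clique cutset. -/
def HasCliqueCutset (G : SimpleGraph V) : Prop :=
  ∃ A C B : Set V, IsSeparation G A C B ∧ A.Nonempty ∧ B.Nonempty ∧ G.IsClique C

/-- `D` is a connected component of `G \ X`: a maximal connected subset of `Xᶜ`. -/
def IsComponentOf (G : SimpleGraph V) (X : Set V) (D : Set V) : Prop :=
  D.Nonempty ∧ D ⊆ Xᶜ ∧ (G.induce D).Connected ∧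
    ∀ D' : Set V, D ⊆ D' → D' ⊆ Xᶜ → (G.induce D').Connected → D' = D

/-- An induced path in `G` ("path" in the paper always means induced path). -/
def IsIPath (G : SimpleGraph V) {u v : V} (P : G.Walk u v) : Prop :=
  P.IsPath ∧ P.toSubgraph.IsInduced

/-- A hole: an induced cycle of length at least four. -/
def IsHole (G : SimpleGraph V) {v : V} (c : G.Walk v v) : Prop :=
  c.IsCycle ∧ 4 ≤ c.length ∧ c.toSubgraph.IsInduced

/-- `G` is sparse: for every hole and every vertex not in it, there is an edge `ab` of the
hole containing all neighbors of the vertex in the hole. -/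
def Sparse (G : SimpleGraph V) : Prop :=
  ∀ (v : V) (c : G.Walk v v), IsHole G c → ∀ x, x ∉ c.support →
    ∃ a b, c.toSubgraph.Adj a b ∧ ∀ y ∈ c.support, G.Adj x y → y = a ∨ y = b

/-- `G` contains a pyramid (necessarily as an induced subgraph). -/
def ContainsPyramid (G : SimpleGraph V) : Prop :=
  ∃ (a b₁ b₂ b₃ : V) (P₁ : G.Walk a b₁) (P₂ : G.Walk a b₂) (P₃ : G.Walk a b₃),
    G.Adj b₁ b₂ ∧ G.Adj b₂ b₃ ∧ G.Adj b₁ b₃ ∧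
    IsIPath G P₁ ∧ IsIPath G P₂ ∧ IsIPath G P₃ ∧
    1 ≤ P₁.length ∧ 1 ≤ P₂.length ∧ 1 ≤ P₃.length ∧
    ¬(P₁.length = 1 ∧ P₂.length = 1) ∧ ¬(P₁.length = 1 ∧ P₃.length = 1) ∧
    ¬(P₂.length = 1 ∧ P₃.length = 1) ∧
    (∀ p ∈ P₁.support, p ≠ a → ∀ q ∈ P₂.support, q ≠ a →
      p ≠ q ∧ (G.Adj p q → p = b₁ ∧ q = b₂)) ∧
    (∀ p ∈ P₁.support, p ≠ a → ∀ q ∈ P₃.support, q ≠ a →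
      p ≠ q ∧ (G.Adj p q → p = b₁ ∧ q = b₃)) ∧
    (∀ p ∈ P₂.support, p ≠ a → ∀ q ∈ P₃.support, q ≠ a →
      p ≠ q ∧ (G.Adj p q → p = b₂ ∧ q = b₃))

/-- `G` contains a prism (necessarily as an induced subgraph). -/
def ContainsPrism (G : SimpleGraph V) : Prop :=
  ∃ (a₁ a₂ a₃ b₁ b₂ b₃ : V) (P₁ : G.Walk a₁ b₁) (P₂ : G.Walk a₂ b₂) (P₃ : G.Walk a₃ b₃),
    G.Adj a₁ a₂ ∧ G.Adj a₂ a₃ ∧ G.Adj a₁ a₃ ∧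
    G.Adj b₁ b₂ ∧ G.Adj b₂ b₃ ∧ G.Adj b₁ b₃ ∧
    IsIPath G P₁ ∧ IsIPath G P₂ ∧ IsIPath G P₃ ∧
    1 ≤ P₁.length ∧ 1 ≤ P₂.length ∧ 1 ≤ P₃.length ∧
    (∀ p ∈ P₁.support, ∀ q ∈ P₂.support,
      p ≠ q ∧ (G.Adj p q → (p = a₁ ∧ q = a₂) ∨ (p = b₁ ∧ q = b₂))) ∧
    (∀ p ∈ P₁.support, ∀ q ∈ P₃.support,
      p ≠ q ∧ (G.Adj p q → (p = a₁ ∧ q = a₃) ∨ (p = b₁ ∧ q = b₃))) ∧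
    (∀ p ∈ P₂.support, ∀ q ∈ P₃.support,
      p ≠ q ∧ (G.Adj p q → (p = a₂ ∧ q = a₃) ∨ (p = b₂ ∧ q = b₃)))

/-- `G` is very sparse: sparse, pyramid-free and prism-free. -/
def VerySparse (G : SimpleGraph V) : Prop :=
  Sparse G ∧ ¬ContainsPyramid G ∧ ¬ContainsPrism G

/-- `G ∈ 𝓕_t`: `G` is very sparse with no clique of size at least `t+1`. -/
def MemF (t : ℕ) (G : SimpleGraph V) : Prop :=
  VerySparse G ∧ ∀ s : Set V, G.IsClique s → s.ncard ≤ t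

/-- `G` has a tree decomposition of width at most `k`. -/
def HasTreewidthAtMost (G : SimpleGraph V) (k : ℕ) : Prop :=
  ∃ (ι : Type) (T : SimpleGraph ι) (χ : ι → Finset V),
    T.IsTree ∧
    (∀ v : V, ∃ t, v ∈ χ t) ∧
    (∀ u v : V, G.Adj u v → ∃ t, u ∈ χ t ∧ v ∈ χ t) ∧
    (∀ v : V, (T.induce {t | v ∈ χ t}).Connected) ∧
    ∀ t, (χ t).card ≤ k + 1

/-- The `n`-by-`n` wall, as a brick wall graph: `n` rows of `2n` vertices each,
with horizontal path edges in each row, and vertical edges between consecutive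
rows placed alternately. -/
def Wall (n : ℕ) : SimpleGraph (Fin n × Fin (2 * n)) :=
  SimpleGraph.fromRel (fun a b =>
    (a.1 = b.1 ∧ a.2.val + 1 = b.2.val) ∨
    (a.2 = b.2 ∧ a.1.val + 1 = b.1.val ∧ (a.1.val + a.2.val) % 2 = 0))

/-- The graph obtained from `G` by subdividing the edge `uv` once (the new vertex
is `none`). -/
def subdivideEdge (G : SimpleGraph V) (u v : V) : SimpleGraph (Option V) :=
  SimpleGraph.fromRel (fun a b =>
    (∃ x y : V, a = some x ∧ b = some y ∧ G.Adj x y ∧ ¬(x = u ∧ y = v) ∧ ¬(x = v ∧ y = u)) ∨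
    (a = none ∧ (b = some u ∨ b = some v)))

/-- `IsSubdivision G H`: `G` is (isomorphic to) a graph obtained from `H` by repeatedly
subdividing edges. -/
inductive IsSubdivision : {α : Type} → SimpleGraph α → {β : Type} → SimpleGraph β → Prop where
  | base {α β : Type} {G : SimpleGraph α} {H : SimpleGraph β} :
      Nonempty (G ≃g H) → IsSubdivision G H
  | step {α β : Type} {G : SimpleGraph α} {H : SimpleGraph β} (u v : β) :
      H.Adj u v → IsSubdivision G (subdivideEdge H u v) → IsSubdivision G H

/-- `G` contains a subdivision of the `t`-by-`t` wall as an induced subgraph. -/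
def ContainsWallSubdiv (G : SimpleGraph V) (t : ℕ) : Prop :=
  ∃ (α : Type) (S : SimpleGraph α), IsSubdivision S (Wall t) ∧ ContainsInduced G S

/-- `G` contains the line graph of a subdivision of the `t`-by-`t` wall as an induced
subgraph. -/
def ContainsLineWallSubdiv (G : SimpleGraph V) (t : ℕ) : Prop :=
  ∃ (α : Type) (S : SimpleGraph α), IsSubdivision S (Wall t) ∧
    ContainsInduced G S.lineGraph

/-- `G` is `𝓣₁`-free: no vertex has two or more neighbors in a hole not containing it. -/
def T1Free (G : SimpleGraph V) : Prop :=
  ∀ (v : V) (c : G.Walk v v), IsHole G c → ∀ x, x ∉ c.support →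
    ∀ y z, y ∈ c.support → z ∈ c.support → G.Adj x y → G.Adj x z → y = z

/-- `G` is `𝓣₂`-free: no vertex has two non-adjacent neighbors in a hole not containing
it, and `G` is pyramid-free and prism-free. -/
def T2Free (G : SimpleGraph V) : Prop :=
  (∀ (v : V) (c : G.Walk v v), IsHole G c → ∀ x, x ∉ c.support →
    ∀ y z, y ∈ c.support → z ∈ c.support → G.Adj x y → G.Adj x z → y ≠ z → G.Adj y z) ∧
  ¬ContainsPyramid G ∧ ¬ContainsPrism G

/-- The weight `w(X)` of a set of vertices. -/
noncomputable def setW (w : V → ℝ) (X : Set V) : ℝ := ∑ᶠ x ∈ X, w x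

/-- `w` is a weight function on `G`: values in `[0,1]` with total weight `1`. -/
def IsWeightFn (w : V → ℝ) : Prop :=
  (∀ v, 0 ≤ w v ∧ w v ≤ 1) ∧ setW w Set.univ = 1

/-- `X` is a `(w, c)`-balanced separator. -/
def IsBalSep (G : SimpleGraph V) (w : V → ℝ) (c : ℝ) (X : Set V) : Prop :=
  ∀ D, IsComponentOf G X D → setW w D ≤ c

/-- `(G, w)` is `d`-unbalanced: `w` is a weight function and there is no
`(w, 1/2)`-balanced separator of size at most `d`. -/
def Unbalanced (G : SimpleGraph V) (w : V → ℝ) (d : ℕ) : Prop :=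
  IsWeightFn w ∧ ∀ X : Set V, X.ncard ≤ d → ¬IsBalSep G w (1 / 2 : ℝ) X

/-- `B = B(K₁,K₂)` is the (unique) component of `G ∖ (K₁ ∪ K₂)` of weight more
than `1/2`.  Then `A(K₁,K₂) = (B ∪ K₁ ∪ K₂)ᶜ` and `S(K₁,K₂) = (A, K₁ ∪ K₂, B)` is the
canonical two-clique-separation for `{K₁, K₂}`. -/
def IsCanonicalB (G : SimpleGraph V) (w : V → ℝ) (K₁ K₂ B : Set V) : Prop :=
  IsComponentOf G (K₁ ∪ K₂) B ∧ (1 / 2 : ℝ) < setW w B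

/-- The open neighborhood `N(D)` of a set of vertices. -/
def nbhdOfSet (G : SimpleGraph V) (D : Set V) : Set V :=
  {v | v ∉ D ∧ ∃ d ∈ D, G.Adj v d}

/-- The canonical two-clique-separation `S(K₁,K₂)` (with big side `B`) is proper. -/
def ProperPair (G : SimpleGraph V) (w : V → ℝ) (K₁ K₂ B : Set V) : Prop :=
  IsCanonicalB G w K₁ K₂ B ∧
  (∃ D, IsComponentOf G (K₁ ∪ K₂) D ∧ D ⊆ (B ∪ K₁ ∪ K₂)ᶜ ∧
    K₁ ∪ K₂ ⊆ nbhdOfSet G D) ∧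
  (K₁.ncard = 1 → K₂.ncard = 1 →
    ¬∃ (x y : V) (P : G.Walk x y), K₁ = {x} ∧ K₂ = {y} ∧ IsIPath G P ∧
      {v | v ∈ P.support} = (B ∪ K₁ ∪ K₂)ᶜ ∪ K₁ ∪ K₂)

/-- The canonical two-clique-separation `S(K₁,K₂)` (with big side `B`) is active,
where `K` bounds the size of the cliques considered. -/
def ActivePair (G : SimpleGraph V) (w : V → ℝ) (K : ℕ) (K₁ K₂ B : Set V) : Prop :=
  ProperPair G w K₁ K₂ B ∧
  ∀ K₁' K₂' B' : Set V, G.IsClique K₁' → G.IsClique K₂' →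
    K₁'.ncard ≤ K → K₂'.ncard ≤ K → ProperPair G w K₁' K₂' B' →
    K₁ ∪ K₂ ≠ K₁' ∪ K₂' →
      ¬(B' ∪ K₁' ∪ K₂' ⊂ B ∪ K₁ ∪ K₂) ∧
      (B' ∪ K₁' ∪ K₂' = B ∪ K₁ ∪ K₂ → B' ⊂ B)

/-- The interiors of two paths from `a` to `b` are disjoint and anticomplete. -/
def IntDisjAnti (G : SimpleGraph V) {a b : V} (P Q : G.Walk a b) : Prop :=
  ∀ x ∈ P.support, x ≠ a → x ≠ b → ∀ y ∈ Q.support, y ≠ a → y ≠ b → x ≠ y ∧ ¬G.Adj x y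

/-- `Q₁, Q₂, Q₃` form a theta (as an induced subgraph of `G`) with ends `a, b`. -/
def ThetaCfg (G : SimpleGraph V) {a b : V} (Q₁ Q₂ Q₃ : G.Walk a b) : Prop :=
  ¬G.Adj a b ∧
  IsIPath G Q₁ ∧ IsIPath G Q₂ ∧ IsIPath G Q₃ ∧
  2 ≤ Q₁.length ∧ 2 ≤ Q₂.length ∧ 2 ≤ Q₃.length ∧
  IntDisjAnti G Q₁ Q₂ ∧ IntDisjAnti G Q₁ Q₃ ∧ IntDisjAnti G Q₂ Q₃

/-- There is a theta through the seagull `a-v-u` in `G`: a theta one of whose ends is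
`a` or `u` and which contains the seagull. -/
def ThetaThroughSeagull (G : SimpleGraph V) (a v u : V) : Prop :=
  (∃ (b : V) (Q₁ Q₂ Q₃ : G.Walk a b), ThetaCfg G Q₁ Q₂ Q₃ ∧ [a, v, u] <+: Q₁.support) ∨
  (∃ (b : V) (Q₁ Q₂ Q₃ : G.Walk u b), ThetaCfg G Q₁ Q₂ Q₃ ∧ [u, v, a] <+: Q₁.support)

/-- `a-v-u` is a heavy seagull in `G`: an induced three-vertex path whose ends both
have degree at least three. -/
def HeavySeagull (G : SimpleGraph V) (a v u : V) : Prop :=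
  a ≠ u ∧ G.Adj a v ∧ G.Adj v u ∧ ¬G.Adj a u ∧ 3 ≤ deg G a ∧ 3 ≤ deg G u

end Paper

namespace Paper

/-- consequences of having no heavy seagull. -/
theorem statement19 {V : Type} [Fintype V] (G : SimpleGraph V) (t : ℕ)
    (hns : ¬∃ a v u : V, HeavySeagull G a v u) :
    (∀ u v : V, 3 ≤ deg G u → 3 ≤ deg G v → G.dist u v ≠ 2) ∧
    (∀ D : Set V, IsComponentOf G {v | 3 ≤ deg G v}ᶜ D → G.IsClique D) ∧
    ((∀ s : Set V, G.IsClique s → s.ncard ≤ t) →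
      ∀ v : V, 3 ≤ deg G v → (G.neighborSet v ∩ {u | 3 ≤ deg G u}).ncard ≤ t - 1) := by
  have key : ∀ a v u : V, 3 ≤ deg G a → 3 ≤ deg G u → a ≠ u → G.Adj a v → G.Adj v u →
      G.Adj a u := by
    intro a v u ha hu hne h1 h2
    by_contra h
    exact hns ⟨a, v, u, hne, h1, h2, h, ha, hu⟩
  refine ⟨?_, ?_, ?_⟩
  · intro u v hu hv hd
    have hr : G.Reachable u v := by
      by_contra hr
      rw [SimpleGraph.dist_eq_zero_of_not_reachable hr] at hd
      omega
    obtain ⟨p, hp⟩ := hr.exists_walk_length_eq_dist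
    rw [hd] at hp
    have hne : u ≠ v := by
      rintro rfl
      simp at hd
    match p, hp with
    | .cons h1 (.cons h2 .nil), _ =>
      have := SimpleGraph.dist_eq_one_iff_adj.2 (key _ _ _ hu hv hne h1 h2)
      omega
  · rintro D ⟨-, hD, hc, -⟩
    rw [compl_compl] at hD
    have aux : ∀ (x y : D), (G.induce D).Walk x y → x = y ∨ G.Adj x y := by
      intro x y p
      induction p with
      | nil => exact Or.inl rfl
      | @cons a b c h q ih =>
        have hab : G.Adj a b := h
        rcases ih with ih | ih
        · subst ih
          exact Or.inr hab
        · by_cases hac : a = c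
          · exact Or.inl hac
          · exact Or.inr (key _ _ _ (hD a.2) (hD c.2)
              (fun h => hac (Subtype.ext h)) hab ih)
    intro x hx y hy hxy
    obtain ⟨p⟩ := hc.preconnected ⟨x, hx⟩ ⟨y, hy⟩
    rcases aux _ _ p with h | h
    · exact absurd (congrArg Subtype.val h) hxy
    · exact h
  · intro hcl v hv
    have hK : G.IsClique (insert v (G.neighborSet v ∩ {u | 3 ≤ deg G u})) := by
      rw [SimpleGraph.isClique_insert]
      refine ⟨?_, fun b hb _ => hb.1⟩
      intro x hx y hy hxy
      exact key x v y hx.2 hy.2 hxy (SimpleGraph.Adj.symm hx.1) hy.1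
    have h := hcl _ hK
    rw [Set.ncard_insert_of_notMem (fun h => G.loopless.irrefl v h.1) (Set.toFinite _)] at h
    omega


end Paper
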